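/- arXiv:1011.6393 — 2 statements merged into one kernel-verified Lean document; each statement's English description precedes it below -/
import Mathlib

section
/- Over any field K, a matrix A in M_n(K) is conjugate to its transpose by an element of GL_n(K). -/
open Polynomial in
/-- A linear functional on `K[X]/(q)`, `q` monic, whose kernel contains no nonzero ideal. -/
lemma exists_functional_monic {K : Type*} [Field K] (q : K[X]) (hq : q.Monic) :
    ∃ l : K[X] →ₗ[K] K, (∀ f, q ∣ f → l f = 0) ∧ ∀ f, (∀ g, l (f * g) = 0) → q ∣ f := by
  refine ⟨(lcoeff K (q.natDegree - 1)).comp (modByMonicHom q), ?_, ?_⟩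
  · intro f hf
    have : f %ₘ q = 0 := (modByMonic_eq_zero_iff_dvd hq).2 hf
    simp [modByMonicHom, this]
  · intro f hf
    rw [← modByMonic_eq_zero_iff_dvd hq]
    by_contra hr
    set r := f %ₘ q with hrdef
    have hlt : r.natDegree < q.natDegree := by
      have := degree_modByMonic_lt f hq
      exact natDegree_lt_natDegree hr this
    have h := hf (X ^ (q.natDegree - 1 - r.natDegree))
    have h1 : (f * X ^ (q.natDegree - 1 - r.natDegree)) %ₘ q
        = r * X ^ (q.natDegree - 1 - r.natDegree) := by
      have h2 : (f * X ^ (q.natDegree - 1 - r.natDegree)) %ₘ q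
          = (r * X ^ (q.natDegree - 1 - r.natDegree)) %ₘ q := by
        rw [← sub_eq_zero, ← sub_modByMonic, modByMonic_eq_zero_iff_dvd hq, ← sub_mul]
        apply Dvd.dvd.mul_right
        refine ⟨f /ₘ q, ?_⟩
        have := modByMonic_add_div f q
        rw [← hrdef] at this
        linear_combination -this
      rw [h2, modByMonic_eq_self_iff hq]
      apply degree_lt_degree
      rw [natDegree_mul_X_pow _ hr]
      omega
    simp only [LinearMap.comp_apply, modByMonicHom, LinearMap.coe_mk, AddHom.coe_mk, h1,
      lcoeff_apply] at h
    rw [coeff_mul_X_pow', if_pos (by omega)] at h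
    have h3 : q.natDegree - 1 - (q.natDegree - 1 - r.natDegree) = r.natDegree := by omega
    rw [h3] at h
    exact hr (leadingCoeff_eq_zero.1 h)

open Polynomial in
lemma exists_functional {K : Type*} [Field K] (q : K[X]) (hq : q ≠ 0) :
    ∃ l : (K[X] ⧸ Submodule.span K[X] {q}) →ₗ[K] K,
      ∀ x : K[X] ⧸ Submodule.span K[X] {q},
        (∀ g : K[X], l (g • x) = 0) → x = 0 := by
  have ha : Associated q (q * C q.leadingCoeff⁻¹) :=
    associated_mul_unit_right _ _ (isUnit_C.2 (by simpa using hq))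
  obtain ⟨l, h1, h2⟩ := exists_functional_monic _ (monic_mul_leadingCoeff_inv hq)
  refine ⟨((Submodule.span K[X] {q}).restrictScalars K).liftQ l ?_, ?_⟩
  · intro x hx
    have hx' : x ∈ Ideal.span {q} := hx
    rw [Ideal.mem_span_singleton] at hx'
    exact h1 _ (ha.symm.dvd.trans hx')
  · intro x hx
    obtain ⟨f, rfl⟩ := Submodule.Quotient.mk_surjective _ x
    rw [Submodule.Quotient.mk_eq_zero]
    change f ∈ Ideal.span {q}
    rw [Ideal.mem_span_singleton]
    refine ha.dvd.trans (h2 f fun g => ?_)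
    have := hx g
    rw [mul_comm]
    exact this

open Polynomial in
/-- Given a finite-dimensional space with endomorphism, there is a nondegenerate bilinear form
for which the endomorphism is self-adjoint. -/
lemma exists_form {K V : Type*} [Field K] [AddCommGroup V] [Module K V] [Module.Finite K V]
    (a : Module.End K V) :
    ∃ B : V →ₗ[K] V →ₗ[K] K, (∀ x y, B (a x) y = B x (a y)) ∧
      ∀ x, (∀ y, B x y = 0) → x = 0 := by
  classical
  have htors : Module.IsTorsion K[X] (Module.AEval' a) := by
    intro x
    refine ⟨⟨minpoly K a, mem_nonZeroDivisors_of_ne_zero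
      (minpoly.ne_zero (Algebra.IsIntegral.isIntegral a))⟩, ?_⟩
    change minpoly K a • x = 0
    apply (Module.AEval'.of a).symm.injective
    rw [Module.AEval.of_symm_smul]
    simp
  obtain ⟨ι, _, p, hp, k, ⟨e⟩⟩ := Module.equiv_directSum_of_isTorsion htors
  have hq : ∀ i, p i ^ k i ≠ 0 := fun i => pow_ne_zero _ (hp i).ne_zero
  choose l hl using fun i => exists_functional _ (hq i)
  let Q : ι → Type _ := fun i => K[X] ⧸ Ideal.span {p i ^ k i}
  let c : ∀ i, Module.AEval' a →ₗ[K[X]] Q i := fun i =>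
    (DirectSum.component K[X] ι (fun i => K[X] ⧸ Submodule.span K[X] {p i ^ k i}) i).comp
      e.toLinearMap
  let φ : ∀ i, V →ₗ[K] Q i := fun i =>
    ((c i).restrictScalars K).comp (Module.AEval'.of a).toLinearMap
  have hφ : ∀ i x, φ i (a x) = (X : K[X]) • φ i x := by
    intro i x
    change c i (Module.AEval'.of a (a x)) = _
    rw [← Module.AEval'.X_smul_of, map_smul]
    rfl
  have hsurj : ∀ i (g : K[X]), ∃ y, ∀ j, φ j y = if j = i then (Ideal.Quotient.mk _ g : Q j) else 0 := by
    intro i g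
    refine ⟨(Module.AEval'.of a).symm (e.symm (DirectSum.lof K[X] ι
      (fun i => K[X] ⧸ Submodule.span K[X] {p i ^ k i}) i (Submodule.Quotient.mk g))), ?_⟩
    intro j
    change (e (e.symm _)) j = _
    rw [e.apply_symm_apply]
    split_ifs with h
    · subst h
      exact DFinsupp.single_eq_same
    · exact DFinsupp.single_eq_of_ne h
  let L : ∀ i, Q i →ₗ[K] K := l
  refine ⟨∑ i, ((LinearMap.mul K (Q i)).compr₂ (L i)).compl₁₂ (φ i) (φ i), ?_, ?_⟩
  · intro x y
    simp only [LinearMap.sum_apply, LinearMap.compl₁₂_apply, LinearMap.compr₂_apply,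
      LinearMap.mul_apply', hφ, smul_mul_assoc, mul_smul_comm]
  · intro x hx
    have key : ∀ i, φ i x = 0 := by
      intro i
      apply hl i
      intro g
      obtain ⟨y, hy⟩ := hsurj i g
      have := hx y
      simp only [LinearMap.sum_apply, LinearMap.compl₁₂_apply, LinearMap.compr₂_apply,
        LinearMap.mul_apply'] at this
      rw [Finset.sum_eq_single i] at this
      · rw [hy i, if_pos rfl, mul_comm] at this
        rw [← this]
        change L i _ = L i _
        congr 1
      · intro j _ hj
        rw [hy j, if_neg hj, mul_zero, map_zero]
      · simp
    have : e (Module.AEval'.of a x) = 0 := by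
      apply DFinsupp.ext
      intro i
      exact key i
    simpa using this

/-- Over any field `K`, a matrix `A ∈ M_n(K)` is conjugate to its transpose by an
element of `GL_n(K)`: there is `P ∈ GL_n(K)` with `P · A · P⁻¹ = Aᵀ`. -/
theorem matrix_conjugate_transpose {K : Type*} [Field K] {n : ℕ} (hn : 0 < n)
    (A : Matrix (Fin n) (Fin n) K) :
    ∃ P : GL (Fin n) K,
      (P : Matrix (Fin n) (Fin n) K) * A * ((P⁻¹ : GL (Fin n) K) : Matrix (Fin n) (Fin n) K) =
        A.transpose := by
  obtain ⟨B, h1, h2⟩ := exists_form (Matrix.toLin' A)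
  let P := LinearMap.toMatrix₂' K B
  have hP : ∀ x y, B x y = x ⬝ᵥ Matrix.mulVec P y := by
    intro x y
    rw [← Matrix.toLinearMap₂'_apply']
    simp [P]
  have hdet : P.det ≠ 0 := by
    intro h
    obtain ⟨v, hv, hv'⟩ := Matrix.exists_vecMul_eq_zero_iff.2 h
    apply hv
    apply h2
    intro y
    rw [hP, Matrix.dotProduct_mulVec, hv', zero_dotProduct]
  have hc : P * A = A.transpose * P := by
    apply Matrix.ext_of_mulVec_single
    intro j
    apply dotProduct_eq
    intro x
    have := h1 x (Pi.single j 1)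
    rw [hP, hP, Matrix.toLin'_apply, Matrix.toLin'_apply, ← Matrix.vecMul_transpose,
      ← Matrix.dotProduct_mulVec, Matrix.mulVec_mulVec, Matrix.mulVec_mulVec] at this
    rw [dotProduct_comm, ← this, dotProduct_comm]
  refine ⟨Matrix.GeneralLinearGroup.mkOfDetNeZero P hdet, ?_⟩
  have h3 : ((Matrix.GeneralLinearGroup.mkOfDetNeZero P hdet : GL (Fin n) K) :
    Matrix (Fin n) (Fin n) K) = P := rfl
  rw [Units.mul_inv_eq_iff_eq_mul, h3, hc]
end

section
/- Let 0 → K → M → N → 0 be an exact sequence of compact finitely generated torsion Λ-modules. The sequence splits up to isogeny (i.e. the tensored sequence over Q_p splits as Λ⊗Q_p-modules) if and only if M contains a Λ-submodule N' such that the composite map N' → N has kernel and cokernel that are torsion abelian groups of bounded exponent. -/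
open TensorProduct

namespace IsogAux

lemma exists_nat_mul (p : ℕ) [Fact p.Prime] (a : ℤ_[p]) (ha : a ≠ 0) :
    ∃ c : ℕ, c ≠ 0 ∧ ∃ b : ℤ_[p], (c : ℤ_[p]) = b * a := by
  refine ⟨p ^ a.valuation, pow_ne_zero _ (Fact.out : p.Prime).ne_zero,
    ((PadicInt.unitCoeff ha)⁻¹ : ℤ_[p]ˣ), ?_⟩
  have h := PadicInt.unitCoeff_spec ha
  rw [Units.eq_inv_mul_iff_mul_eq, Nat.cast_pow]
  exact h.symm

lemma torsion_of_tmul (p : ℕ) [Fact p.Prime] {M : Type*} [AddCommGroup M] [Module ℤ_[p] M]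
    (x : M) (h : x ⊗ₜ[ℤ_[p]] (1 : ℚ_[p]) = 0) : ∃ c : ℕ, c ≠ 0 ∧ c • x = 0 := by
  have h2 : TensorProduct.mk ℤ_[p] ℚ_[p] M 1 x = 0 := by
    have := congrArg (TensorProduct.comm ℤ_[p] M ℚ_[p]) h
    simpa using this
  rw [IsLocalizedModule.eq_zero_iff (nonZeroDivisors ℤ_[p])] at h2
  obtain ⟨⟨a, ha⟩, h2⟩ := h2
  obtain ⟨c, hc, b, hb⟩ := exists_nat_mul p a (nonZeroDivisors.ne_zero ha)
  refine ⟨c, hc, ?_⟩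
  have h3 : a • x = 0 := h2
  rw [← Nat.cast_smul_eq_nsmul ℤ_[p], hb, mul_smul, h3, smul_zero]

lemma exists_tmul (p : ℕ) [Fact p.Prime] {M : Type*} [AddCommGroup M] [Module ℤ_[p] M]
    (z : M ⊗[ℤ_[p]] ℚ_[p]) : ∃ c : ℕ, c ≠ 0 ∧ ∃ m : M, c • z = m ⊗ₜ[ℤ_[p]] (1 : ℚ_[p]) := by
  obtain ⟨⟨m, ⟨a, ha⟩⟩, h⟩ := IsLocalizedModule.surj (nonZeroDivisors ℤ_[p])
    (TensorProduct.mk ℤ_[p] ℚ_[p] M 1) (TensorProduct.comm ℤ_[p] M ℚ_[p] z)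
  obtain ⟨c, hc, b, hb⟩ := exists_nat_mul p a (nonZeroDivisors.ne_zero ha)
  have h3 : a • (TensorProduct.comm ℤ_[p] M ℚ_[p] z) = (1 : ℚ_[p]) ⊗ₜ m := h
  have h4 : a • z = m ⊗ₜ (1 : ℚ_[p]) := by
    apply (TensorProduct.comm ℤ_[p] M ℚ_[p]).injective
    rw [map_smul, h3, TensorProduct.comm_tmul]
  refine ⟨c, hc, b • m, ?_⟩
  rw [← Nat.cast_smul_eq_nsmul ℤ_[p], hb, mul_smul, h4, TensorProduct.smul_tmul']

lemma bounded {R P : Type*} [CommRing R] [AddCommGroup P] [Module R P] [Module.Finite R P]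
    (h : ∀ x : P, ∃ c : ℕ, c ≠ 0 ∧ c • x = 0) : ∃ c : ℕ, c ≠ 0 ∧ ∀ x : P, c • x = 0 := by
  obtain ⟨S, hS⟩ := (Module.Finite.fg_top : (⊤ : Submodule R P).FG)
  choose c hc0 hc using h
  refine ⟨∏ x ∈ S, c x, Finset.prod_ne_zero_iff.2 fun x _ => hc0 x, fun x => ?_⟩
  have hx : x ∈ Submodule.span R (S : Set P) := hS ▸ Submodule.mem_top
  induction hx using Submodule.span_induction with
  | mem y hy =>
    obtain ⟨d, hd⟩ := Finset.dvd_prod_of_mem c (Finset.mem_coe.1 hy)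
    rw [hd, mul_comm, mul_smul, hc, smul_zero]
  | zero => simp
  | add a b _ _ ha hb => rw [smul_add, ha, hb, add_zero]
  | smul r a _ ha => rw [smul_comm, ha, smul_zero]

end IsogAux

/-- Let `0 → K → M → N → 0` be an exact sequence of compact finitely generated torsion
`Λ = ℤ_p[[T]]`-modules.  The sequence splits up to isogeny (i.e. the sequence tensored
with `ℚ_p` over `ℤ_p` splits as a sequence of `Λ ⊗ ℚ_p`-modules) if and only if `M`
contains a `Λ`-submodule `N'` such that the composite `N' → N` is an isogeny: its kernel
and cokernel are torsion abelian groups of bounded exponent. -/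
theorem splits_up_to_isogeny_iff (p : ℕ) [Fact p.Prime]
    (K M N : Type*) [AddCommGroup K] [AddCommGroup M] [AddCommGroup N]
    [Module ℤ_[p] K] [Module ℤ_[p] M] [Module ℤ_[p] N]
    [Module (PowerSeries ℤ_[p]) K] [Module (PowerSeries ℤ_[p]) M]
    [Module (PowerSeries ℤ_[p]) N]
    [IsScalarTower ℤ_[p] (PowerSeries ℤ_[p]) K]
    [IsScalarTower ℤ_[p] (PowerSeries ℤ_[p]) M]
    [IsScalarTower ℤ_[p] (PowerSeries ℤ_[p]) N]
    [SMulCommClass ℤ_[p] (PowerSeries ℤ_[p]) K]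
    [SMulCommClass ℤ_[p] (PowerSeries ℤ_[p]) M]
    [SMulCommClass ℤ_[p] (PowerSeries ℤ_[p]) N]
    [Module.Finite (PowerSeries ℤ_[p]) K] [Module.Finite (PowerSeries ℤ_[p]) M]
    [Module.Finite (PowerSeries ℤ_[p]) N]
    -- the modules are torsion Λ-modules
    (htorK : ∀ x : K, ∃ lam : PowerSeries ℤ_[p], lam ≠ 0 ∧ lam • x = 0)
    (htorM : ∀ x : M, ∃ lam : PowerSeries ℤ_[p], lam ≠ 0 ∧ lam • x = 0)
    (htorN : ∀ x : N, ∃ lam : PowerSeries ℤ_[p], lam ≠ 0 ∧ lam • x = 0)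
    -- the exact sequence 0 → K → M → N → 0
    (f : K →ₗ[PowerSeries ℤ_[p]] M) (g : M →ₗ[PowerSeries ℤ_[p]] N)
    (hf : Function.Injective f) (hg : Function.Surjective g)
    (hex : LinearMap.range f = LinearMap.ker g) :
    -- `g ⊗ ℚ_p` admits a `Λ`-linear section
    (∃ s : N ⊗[ℤ_[p]] ℚ_[p] →ₗ[PowerSeries ℤ_[p]] M ⊗[ℤ_[p]] ℚ_[p],
        ∀ x : N ⊗[ℤ_[p]] ℚ_[p],
          LinearMap.rTensor ℚ_[p] (g.restrictScalars ℤ_[p]) (s x) = x) ↔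
    ∃ N' : Submodule (PowerSeries ℤ_[p]) M, ∃ c : ℕ, c ≠ 0 ∧
      (∀ x ∈ N', g x = 0 → c • x = 0) ∧
      (∀ y : N, ∃ x ∈ N', g x = c • y) := by
  constructor
  · rintro ⟨s, hs⟩
    let ι : M →ₗ[PowerSeries ℤ_[p]] M ⊗[ℤ_[p]] ℚ_[p] :=
      { toFun := fun m => m ⊗ₜ 1
        map_add' := fun a b => TensorProduct.add_tmul _ _ _
        map_smul' := fun r a => (TensorProduct.smul_tmul' r a 1).symm }
    let N' : Submodule (PowerSeries ℤ_[p]) M := (LinearMap.range s).comap ι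
    have hker : ∀ x : ↥(N' ⊓ LinearMap.ker g), ∃ c : ℕ, c ≠ 0 ∧ c • x = 0 := by
      rintro ⟨x, ⟨z, hz⟩, hx⟩
      have hx' : g x = 0 := hx
      have hz' : s z = x ⊗ₜ (1 : ℚ_[p]) := hz
      have h1 := hs z
      rw [hz', LinearMap.rTensor_tmul, LinearMap.restrictScalars_apply, hx',
        TensorProduct.zero_tmul] at h1
      rw [← h1, map_zero] at hz'
      obtain ⟨c, hc, h⟩ := IsogAux.torsion_of_tmul p x hz'.symm
      exact ⟨c, hc, Subtype.ext h⟩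
    have hcok : ∀ x : N ⧸ N'.map g, ∃ c : ℕ, c ≠ 0 ∧ c • x = 0 := by
      intro x
      obtain ⟨y, rfl⟩ := Submodule.Quotient.mk_surjective _ x
      obtain ⟨c, hc, m, hm⟩ := IsogAux.exists_tmul p (s (y ⊗ₜ (1 : ℚ_[p])))
      have hmN : m ∈ N' := ⟨c • (y ⊗ₜ (1 : ℚ_[p])), by rw [map_nsmul, hm]; rfl⟩
      have h1 := congrArg (LinearMap.rTensor ℚ_[p] (g.restrictScalars ℤ_[p])) hm
      rw [map_nsmul, hs, LinearMap.rTensor_tmul, LinearMap.restrictScalars_apply] at h1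
      have h2 : (g m - c • y) ⊗ₜ[ℤ_[p]] (1 : ℚ_[p]) = 0 := by
        rw [TensorProduct.sub_tmul, ← h1, TensorProduct.smul_tmul', sub_self]
      obtain ⟨d, hd, h3⟩ := IsogAux.torsion_of_tmul p _ h2
      refine ⟨d * c, mul_ne_zero hd hc, ?_⟩
      rw [← Submodule.Quotient.mk_smul, Submodule.Quotient.mk_eq_zero]
      refine ⟨d • m, N'.nsmul_mem hmN d, ?_⟩
      rw [smul_sub, sub_eq_zero] at h3
      rw [map_nsmul, h3, mul_smul]
    obtain ⟨c₁, hc₁, h₁⟩ := IsogAux.bounded (R := PowerSeries ℤ_[p]) hker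
    obtain ⟨c₂, hc₂, h₂⟩ := IsogAux.bounded (R := PowerSeries ℤ_[p]) hcok
    refine ⟨N', c₁ * c₂, mul_ne_zero hc₁ hc₂, ?_, ?_⟩
    · intro x hx hgx
      have := congrArg Subtype.val (h₁ ⟨x, hx, hgx⟩)
      have h : c₁ • x = 0 := this
      rw [mul_comm, mul_smul, h, smul_zero]
    · intro y
      have h := h₂ (Submodule.Quotient.mk y)
      rw [← Submodule.Quotient.mk_smul, Submodule.Quotient.mk_eq_zero] at h
      obtain ⟨x, hx, hxy⟩ := h
      exact ⟨c₁ • x, N'.nsmul_mem hx _, by rw [map_nsmul, hxy, mul_smul]⟩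
  · rintro ⟨N', c, hc, h1, h2⟩
    choose t htN ht using h2
    have key : ∀ x ∈ N', ∀ x' ∈ N', g x = g x' → c • x = c • x' := by
      intro x hx x' hx' h
      rw [← sub_eq_zero, ← smul_sub]
      exact h1 _ (N'.sub_mem hx hx') (by rw [map_sub, h, sub_self])
    let σ : N →ₗ[PowerSeries ℤ_[p]] M :=
      { toFun := fun y => c • t y
        map_add' := fun a b => by
          rw [← smul_add]
          exact key _ (htN _) _ (N'.add_mem (htN _) (htN _))
            (by rw [map_add, ht, ht, ht, smul_add])
        map_smul' := fun r a => by
          rw [RingHom.id_apply, smul_comm r c]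
          exact key _ (htN _) _ (N'.smul_mem _ (htN _))
            (by rw [map_smul, ht, ht, smul_comm]) }
    have hσ : ∀ y, g (σ y) = (c * c) • y := fun y => by
      change g (c • t y) = _
      rw [map_nsmul, ht, mul_smul]
    let q : ℚ_[p] := ((c * c : ℕ) : ℚ_[p])⁻¹
    refine ⟨TensorProduct.AlgebraTensorModule.map σ (LinearMap.mulLeft ℤ_[p] q), fun x => ?_⟩
    induction x using TensorProduct.induction_on with
    | zero => simp only [map_zero]
    | add a b ha hb => rw [map_add, map_add, ha, hb]
    | tmul y r =>
      rw [TensorProduct.AlgebraTensorModule.map_tmul, LinearMap.rTensor_tmul,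
        LinearMap.restrictScalars_apply, hσ, ← Nat.cast_smul_eq_nsmul ℤ_[p],
        TensorProduct.smul_tmul, Nat.cast_smul_eq_nsmul, LinearMap.mulLeft_apply,
        nsmul_eq_mul, mul_inv_cancel_left₀]
      exact Nat.cast_ne_zero.2 (mul_ne_zero hc hc)
end
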